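/- arXiv:1507.01141 — 4 statements merged into one kernel-verified Lean document; each statement's English description precedes it below -/
import Mathlib

section
/- Assume the singular-system hypotheses for T. Let δ > 0, E > 0, g ∈ H₂ and suppose f_a, f_b ∈ H₁ satisfy ‖T f_a − g‖ ≤ δ, ‖T f_b − g‖ ≤ δ, ‖f_a‖ ≤ E and ‖f_b‖ ≤ E. Then for every integer N > Nμ one has ‖P (f_a − f_b)‖ ≤ 2·δ/σ_{Nμ} + (2·δ·Bμ/A)·exp((α−βμ)·N)/√(1−exp(−2·(α−βμ))) + 2·E·Bμ·exp(−βμ·N)/√(exp(2·βμ)−1). -/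
open scoped RealInnerProductSpace

/-- Cauchy–Schwarz combined with Bessel's inequality. -/
lemma Orthonormal.norm_sum_inner_smul_le {ι H F : Type*} [NormedAddCommGroup H]
    [InnerProductSpace ℝ H] [NormedAddCommGroup F] [NormedSpace ℝ F] {e : ι → H}
    (he : Orthonormal ℝ e) (x : H) (w : ι → F) (s : Finset ι) :
    ‖∑ i ∈ s, ⟪e i, x⟫ • w i‖ ≤ ‖x‖ * √(∑ i ∈ s, ‖w i‖ ^ 2) := by
  calc ‖∑ i ∈ s, ⟪e i, x⟫ • w i‖ ≤ ∑ i ∈ s, ‖⟪e i, x⟫‖ * ‖w i‖ :=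
        (norm_sum_le _ _).trans_eq (by simp only [norm_smul])
    _ ≤ √(∑ i ∈ s, ‖⟪e i, x⟫‖ ^ 2) * √(∑ i ∈ s, ‖w i‖ ^ 2) :=
        Real.sum_mul_le_sqrt_mul_sqrt _ _ _
    _ ≤ ‖x‖ * √(∑ i ∈ s, ‖w i‖ ^ 2) := by
        gcongr
        exact Real.sqrt_le_iff.2 ⟨norm_nonneg x, he.sum_inner_products_le x⟩

lemma sum_exp_neg_mul_le {ι : Type*} {s : Finset ι} {φ : ι → ℕ} (hφ : Set.InjOn φ s)
    {r : ℝ} (hr : 0 < r) :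
    ∑ i ∈ s, Real.exp (-r * φ i) ≤ (1 - Real.exp (-r))⁻¹ := by
  have hlt : Real.exp (-r) < 1 := Real.exp_zero ▸ Real.exp_lt_exp.2 (by linarith)
  have hexp (k : ℕ) : Real.exp (-r * k) = Real.exp (-r) ^ k := by
    rw [← Real.exp_nat_mul, mul_comm]
  simp only [hexp]
  rw [← Finset.sum_image (f := fun k ↦ Real.exp (-r) ^ k) hφ,
    ← tsum_geometric_of_lt_one (Real.exp_pos _).le hlt]
  exact (summable_geometric_of_lt_one (Real.exp_pos _).le hlt).sum_le_tsum _
    fun _ _ ↦ by positivity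

lemma Orthonormal.norm_sum_inner_smul_le_of_exp_decay {ι H F : Type*} [NormedAddCommGroup H]
    [InnerProductSpace ℝ H] [NormedAddCommGroup F] [NormedSpace ℝ F] {e : ι → H}
    (he : Orthonormal ℝ e) {x : H} {w : ι → F} {s : Finset ι} {φ : ι → ℕ}
    (hφ : Set.InjOn φ s) {C D r : ℝ} (hC : 0 ≤ C) (hr : 0 < r) (hx : ‖x‖ ≤ D)
    (hw : ∀ i ∈ s, ‖w i‖ ≤ C * Real.exp (-r * φ i)) :
    ‖∑ i ∈ s, ⟪e i, x⟫ • w i‖ ≤ D * (C / √(1 - Real.exp (-2 * r))) := by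
  have hsum : ∑ i ∈ s, ‖w i‖ ^ 2 ≤ C ^ 2 * (1 - Real.exp (-2 * r))⁻¹ := by
    calc ∑ i ∈ s, ‖w i‖ ^ 2 ≤ ∑ i ∈ s, C ^ 2 * Real.exp (-(2 * r) * φ i) := by
          refine Finset.sum_le_sum fun i hi ↦ ?_
          have h := pow_le_pow_left₀ (norm_nonneg _) (hw i hi) 2
          rwa [mul_pow, ← Real.exp_nat_mul,
            show ((2 : ℕ) : ℝ) * (-r * φ i) = -(2 * r) * φ i by push_cast; ring] at h
      _ ≤ C ^ 2 * (1 - Real.exp (-2 * r))⁻¹ := by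
          rw [← Finset.mul_sum, neg_mul 2 r]
          gcongr
          exact sum_exp_neg_mul_le hφ (by positivity)
  refine (he.norm_sum_inner_smul_le x w s).trans ?_
  have hD : 0 ≤ D := (norm_nonneg x).trans hx
  gcongr
  refine (Real.sqrt_le_sqrt hsum).trans_eq ?_
  rw [Real.sqrt_mul (sq_nonneg C), Real.sqrt_sq hC, Real.sqrt_inv, div_eq_mul_inv]

lemma Orthonormal.norm_sum_smul_sq {ι H : Type*} [NormedAddCommGroup H]
    [InnerProductSpace ℝ H] {e : ι → H} (he : Orthonormal ℝ e) (c : ι → ℝ) (s : Finset ι) :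
    ‖∑ i ∈ s, c i • e i‖ ^ 2 = ∑ i ∈ s, c i ^ 2 := by
  rw [← real_inner_self_eq_norm_sq, he.inner_sum]
  simp [sq]

lemma norm_le_of_idempotent_of_adjoint_eq_self {H : Type*} [NormedAddCommGroup H]
    [InnerProductSpace ℝ H] [CompleteSpace H] {P : H →L[ℝ] H} (hP_idem : ∀ x, P (P x) = P x)
    (hP_sa : ContinuousLinearMap.adjoint P = P) (x : H) : ‖P x‖ ≤ ‖x‖ := by
  have h : ‖P x‖ * ‖P x‖ ≤ ‖x‖ * ‖P x‖ := by
    calc ‖P x‖ * ‖P x‖ = ⟪P x, P x⟫ := (real_inner_self_eq_norm_mul_norm _).symm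
      _ = ⟪x, P x⟫ := by
          rw [← ContinuousLinearMap.adjoint_inner_right, hP_sa, hP_idem]
      _ ≤ ‖x‖ * ‖P x‖ := real_inner_le_norm _ _
  rcases (norm_nonneg (P x)).eq_or_lt with h0 | h0
  · rw [← h0]
    exact norm_nonneg x
  · exact le_of_mul_le_mul_right h h0

/-- The split-index error bound (equation (12) of the paper): for any two
admissible solutions and any cut-off index `N > Nμ`, the error on the region of
interest is bounded by three terms. -/
theorem stability_bound_split_index
    {H₁ H₂ : Type*} [NormedAddCommGroup H₁] [InnerProductSpace ℝ H₁] [CompleteSpace H₁]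
    [NormedAddCommGroup H₂] [InnerProductSpace ℝ H₂] [CompleteSpace H₂]
    (T : H₁ →L[ℝ] H₂) (u : ℤ → H₁) (v : ℤ → H₂) (σ : ℤ → ℝ)
    (hu : Orthonormal ℝ u)
    (hu_basis : (Submodule.span ℝ (Set.range u)).topologicalClosure = ⊤)
    (hv : Orthonormal ℝ v)
    (hσ_anti : Antitone σ) (hσ_pos : ∀ n, 0 < σ n) (hσ_lt : ∀ n, σ n < 1)
    (hTu : ∀ n, T (u n) = σ n • v n)
    (hTv : ∀ n, ContinuousLinearMap.adjoint T (v n) = σ n • u n)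
    (Nμ : ℤ) (hNμ : 1 ≤ Nμ)
    (A Bμ α βμ : ℝ) (hA : 0 < A) (hB : 0 < Bμ) (hβ : 0 < βμ) (hαβ : βμ < α)
    (hσ_low : ∀ n : ℤ, Nμ ≤ n → A * Real.exp (-α * (n : ℝ)) ≤ σ n)
    (P : H₁ →L[ℝ] H₁) (hP_idem : ∀ x, P (P x) = P x)
    (hP_sa : ContinuousLinearMap.adjoint P = P)
    (hPu : ∀ n : ℤ, Nμ ≤ n → ‖P (u n)‖ ≤ Bμ * Real.exp (-βμ * (n : ℝ)))
    (δ E : ℝ) (hδ : 0 < δ) (hE : 0 < E)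
    (g : H₂) (fa fb : H₁)
    (hfa : ‖T fa - g‖ ≤ δ) (hfb : ‖T fb - g‖ ≤ δ)
    (hfaE : ‖fa‖ ≤ E) (hfbE : ‖fb‖ ≤ E) :
    ∀ N : ℤ, Nμ < N →
      ‖P (fa - fb)‖ ≤ 2 * δ / σ Nμ +
        (2 * δ * Bμ / A) * Real.exp ((α - βμ) * (N : ℝ)) /
          Real.sqrt (1 - Real.exp (-2 * (α - βμ))) +
        2 * E * Bμ * Real.exp (-βμ * (N : ℝ)) / Real.sqrt (Real.exp (2 * βμ) - 1) := by
  intro N hN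
  set f := fa - fb with hf
  have hfE : ‖f‖ ≤ 2 * E := (norm_sub_le _ _).trans (by linarith)
  have hTf : ‖T f‖ ≤ 2 * δ := by
    have h : T f = (T fa - g) - (T fb - g) := by simp [hf]
    rw [h]
    exact (norm_sub_le _ _).trans (by linarith)
  have hcoef (n : ℤ) : ⟪v n, T f⟫ = σ n * ⟪u n, f⟫ := by
    rw [← ContinuousLinearMap.adjoint_inner_left, hTv, real_inner_smul_left]
  have hlow (s : Finset ℤ) (hs : ∀ n ∈ s, n ≤ Nμ) :
      ‖P (∑ n ∈ s, ⟪u n, f⟫ • u n)‖ ≤ 2 * δ / σ Nμ := by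
    refine (norm_le_of_idempotent_of_adjoint_eq_self hP_idem hP_sa _).trans ?_
    rw [le_div_iff₀ (hσ_pos Nμ)]
    refine le_trans (abs_le_of_sq_le_sq' ?_ (norm_nonneg (T f))).2 hTf
    rw [mul_pow, hu.norm_sum_smul_sq, Finset.sum_mul]
    refine le_trans (Finset.sum_le_sum fun n hn ↦ ?_) (hv.sum_inner_products_le (T f) (s := s))
    rw [hcoef, Real.norm_eq_abs, sq_abs, mul_pow, mul_comm]
    have := (hσ_pos Nμ).le
    gcongr
    exact hσ_anti (hs n hn)
  have hmid (s : Finset ℤ) (hs : ∀ n ∈ s, Nμ < n ∧ n ≤ N) :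
      ‖P (∑ n ∈ s, ⟪u n, f⟫ • u n)‖ ≤ (2 * δ * Bμ / A) * Real.exp ((α - βμ) * (N : ℝ)) /
          √(1 - Real.exp (-2 * (α - βμ))) := by
    have hsum : P (∑ n ∈ s, ⟪u n, f⟫ • u n) = ∑ n ∈ s, ⟪v n, T f⟫ • ((σ n)⁻¹ • P (u n)) := by
      rw [map_sum]
      refine Finset.sum_congr rfl fun n _ ↦ ?_
      rw [map_smul, hcoef, smul_smul, mul_right_comm, mul_inv_cancel₀ (hσ_pos n).ne', one_mul]
    have hinj : Set.InjOn (fun n : ℤ ↦ (N - n).toNat) s := by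
      intro m hm n hn h
      have := hs m hm
      have := hs n hn
      simp only at h
      omega
    rw [hsum]
    refine (hv.norm_sum_inner_smul_le_of_exp_decay hinj
      (C := Bμ / A * Real.exp ((α - βμ) * N)) (r := α - βμ) (by positivity) (by linarith) hTf
      fun n hn ↦ ?_).trans_eq (by ring)
    have hφ : (((N - n).toNat : ℕ) : ℝ) = N - n := by
      have h : (((N - n).toNat : ℕ) : ℤ) = N - n := Int.toNat_of_nonneg (by linarith [hs n hn])
      exact_mod_cast h
    rw [norm_smul, norm_inv, Real.norm_of_nonneg (hσ_pos n).le, hφ]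
    calc (σ n)⁻¹ * ‖P (u n)‖
        ≤ (A * Real.exp (-α * n))⁻¹ * (Bμ * Real.exp (-βμ * n)) := by
          have := hPu n (hs n hn).1.le
          have := hσ_low n (hs n hn).1.le
          gcongr
      _ = Bμ / A * (Real.exp (α * n) * Real.exp (-βμ * n)) := by
          rw [neg_mul α, Real.exp_neg]
          field_simp
      _ = Bμ / A * (Real.exp ((α - βμ) * N) * Real.exp (-(α - βμ) * (N - n))) := by
          rw [← Real.exp_add, ← Real.exp_add]
          ring_nf
      _ = _ := by ring
  have hhigh (s : Finset ℤ) (hs : ∀ n ∈ s, N < n) :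
      ‖P (∑ n ∈ s, ⟪u n, f⟫ • u n)‖ ≤
        2 * E * Bμ * Real.exp (-βμ * (N : ℝ)) / √(Real.exp (2 * βμ) - 1) := by
    have hinj : Set.InjOn (fun n : ℤ ↦ (n - N - 1).toNat) s := by
      intro m hm n hn h
      have := hs m hm
      have := hs n hn
      simp only at h
      omega
    have hsqrt : √(Real.exp (2 * βμ) - 1) = Real.exp βμ * √(1 - Real.exp (-2 * βμ)) := by
      have h : Real.exp (2 * βμ) - 1 = Real.exp βμ ^ 2 * (1 - Real.exp (-2 * βμ)) := by
        rw [mul_sub, ← Real.exp_nat_mul, ← Real.exp_add]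
        simp
      rw [h, Real.sqrt_mul (sq_nonneg _), Real.sqrt_sq (Real.exp_pos βμ).le]
    simp only [map_sum, map_smul]
    refine (hu.norm_sum_inner_smul_le_of_exp_decay hinj
      (C := Bμ * Real.exp (-βμ * (N + 1))) (r := βμ) (by positivity) hβ hfE
      fun n hn ↦ ?_).trans_eq ?_
    · have hφ : (((n - N - 1).toNat : ℕ) : ℝ) = n - N - 1 := by
        have h : (((n - N - 1).toNat : ℕ) : ℤ) = n - N - 1 :=
          Int.toNat_of_nonneg (by linarith [Int.add_one_le_iff.2 (hs n hn)])
        exact_mod_cast h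
      refine (hPu n (hN.trans (hs n hn)).le).trans_eq ?_
      rw [hφ, mul_assoc, ← Real.exp_add]
      ring_nf
    · rw [hsqrt, mul_add, Real.exp_add, mul_one, Real.exp_neg βμ]
      field_simp
  have hpartial (s : Finset ℤ) : ‖P (∑ n ∈ s, ⟪u n, f⟫ • u n)‖ ≤ 2 * δ / σ Nμ +
        (2 * δ * Bμ / A) * Real.exp ((α - βμ) * (N : ℝ)) / √(1 - Real.exp (-2 * (α - βμ))) +
        2 * E * Bμ * Real.exp (-βμ * (N : ℝ)) / √(Real.exp (2 * βμ) - 1) := by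
    rw [← Finset.sum_filter_add_sum_filter_not s (· ≤ N),
      ← Finset.sum_filter_add_sum_filter_not (s.filter (· ≤ N)) (· ≤ Nμ), map_add, map_add]
    refine norm_add₃_le.trans (add_le_add_three (hlow _ ?_) (hmid _ ?_) (hhigh _ ?_))
    all_goals
      intro n hn
      simp only [Finset.mem_filter, not_le] at hn
      tauto
  have hlim : HasSum (fun n ↦ ⟪u n, f⟫ • u n) f := by
    have h := (HilbertBasis.mk hu hu_basis.ge).hasSum_repr f
    simpa only [HilbertBasis.repr_apply_apply, HilbertBasis.coe_mk] using h
  exact le_of_tendsto ((P.continuous.norm.tendsto f).comp hlim)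
    (Filter.Eventually.of_forall hpartial)
end

section
/- Let H₁ and H₂ be real Hilbert spaces and T : H₁ → H₂ a bounded linear operator. Let δ > 0, E > 0, g ∈ H₂ and f_ex ∈ H₁ with ‖T f_ex − g‖ ≤ δ and ‖f_ex‖ ≤ E. Set η = δ²/E² and suppose f_η ∈ H₁ minimizes the Tikhonov functional Φ_η(f) = ‖T f − g‖² + η·‖f‖² over H₁. Then ‖T f_η − g‖ ≤ √2·δ and ‖f_η‖ ≤ √2·E; consequently ‖T f_η − T f_ex‖ ≤ (1+√2)·δ and ‖f_η − f_ex‖ ≤ (1+√2)·E. -/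
open scoped RealInnerProductSpace

/-- Basic properties of the Tikhonov minimizer with `η = δ²/E²`: it is
data-consistent up to `√2·δ` and norm-bounded by `√2·E`, hence compatible with
the exact solution up to the stated factors. -/
theorem tikhonov_minimizer_admissible
    {H₁ H₂ : Type*} [NormedAddCommGroup H₁] [InnerProductSpace ℝ H₁] [CompleteSpace H₁]
    [NormedAddCommGroup H₂] [InnerProductSpace ℝ H₂] [CompleteSpace H₂]
    (T : H₁ →L[ℝ] H₂)
    (δ E : ℝ) (hδ : 0 < δ) (hE : 0 < E)
    (g : H₂) (fex : H₁) (hfex : ‖T fex - g‖ ≤ δ) (hfexE : ‖fex‖ ≤ E)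
    (fη : H₁)
    (hmin : ∀ f : H₁, ‖T fη - g‖ ^ 2 + (δ ^ 2 / E ^ 2) * ‖fη‖ ^ 2 ≤
      ‖T f - g‖ ^ 2 + (δ ^ 2 / E ^ 2) * ‖f‖ ^ 2) :
    ‖T fη - g‖ ≤ Real.sqrt 2 * δ ∧ ‖fη‖ ≤ Real.sqrt 2 * E ∧
      ‖T fη - T fex‖ ≤ (1 + Real.sqrt 2) * δ ∧
      ‖fη - fex‖ ≤ (1 + Real.sqrt 2) * E := by
  have hpen : ∀ x : ℝ, δ ^ 2 / E ^ 2 * x ^ 2 = (δ * (x / E)) ^ 2 := fun x => by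
    field_simp
  have hbound : ‖T fη - g‖ ^ 2 + (δ * (‖fη‖ / E)) ^ 2 ≤ 2 * δ ^ 2 := by
    have hres : ‖T fex - g‖ ^ 2 ≤ δ ^ 2 := by gcongr
    have hratio : ‖fex‖ / E ≤ 1 := (div_le_one hE).2 hfexE
    have hnorm : (δ * (‖fex‖ / E)) ^ 2 ≤ (δ * 1) ^ 2 := by gcongr
    have h := hmin fex
    rw [hpen, hpen] at h
    linarith
  have hsqrt : (Real.sqrt 2 * δ) ^ 2 = 2 * δ ^ 2 := by
    rw [mul_pow, Real.sq_sqrt zero_le_two]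
  have hdata : ‖T fη - g‖ ≤ Real.sqrt 2 * δ :=
    le_of_abs_le <| abs_le_of_sq_le_sq
      (by rw [hsqrt]; linarith [sq_nonneg (δ * (‖fη‖ / E))]) (by positivity)
  have hsol : ‖fη‖ ≤ Real.sqrt 2 * E := by
    have h : δ * (‖fη‖ / E) ≤ Real.sqrt 2 * δ :=
      le_of_abs_le <| abs_le_of_sq_le_sq
        (by rw [hsqrt]; linarith [sq_nonneg ‖T fη - g‖]) (by positivity)
    rw [mul_comm _ δ] at h
    exact (div_le_iff₀ hE).1 (le_of_mul_le_mul_left h hδ)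
  refine ⟨hdata, hsol, ?_, ?_⟩
  · have h := norm_sub_le (T fη - g) (T fex - g)
    rw [sub_sub_sub_cancel_right] at h
    linarith
  · linarith [norm_sub_le fη fex]
end

section
/- Let H₁ and H₂ be real Hilbert spaces, T : H₁ → H₂ a bounded linear operator, and (uₙ)ₙ∈ℕ an orthonormal sequence in H₁ with ‖T uₙ‖ → 0 as n → ∞. Then for every E > 0 and every function ω : ℝ → ℝ with ω(t) → 0 as t → 0⁺, there exists f ∈ H₁ with ‖f‖ = E and ω(‖T f‖) < ‖f‖. In other words, no stability estimate of the form ‖f‖ ≤ ω(‖T f‖) can hold uniformly on the ball {f : ‖f‖ ≤ E}. -/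
open scoped RealInnerProductSpace

/-- No uniform stability estimate on the whole interval with only an `L²`
prior: if `‖T uₙ‖ → 0` along an orthonormal sequence, then for any norm bound
`E` and any modulus `ω` vanishing at `0⁺` there is an `f` of norm `E` with
`ω(‖T f‖) < ‖f‖`. -/
theorem no_full_interval_stability
    {H₁ H₂ : Type*} [NormedAddCommGroup H₁] [InnerProductSpace ℝ H₁] [CompleteSpace H₁]
    [NormedAddCommGroup H₂] [InnerProductSpace ℝ H₂] [CompleteSpace H₂]
    (T : H₁ →L[ℝ] H₂) (u : ℕ → H₁) (hu : Orthonormal ℝ u)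
    (hTu : Filter.Tendsto (fun n => ‖T (u n)‖) Filter.atTop (nhds 0)) :
    ∀ E : ℝ, 0 < E → ∀ ω : ℝ → ℝ,
      Filter.Tendsto ω (nhdsWithin 0 (Set.Ici 0)) (nhds 0) →
      ∃ f : H₁, ‖f‖ = E ∧ ω ‖T f‖ < ‖f‖ := by
  intro E hE ω hω
  have hnorm : ∀ n, ‖E • u n‖ = E := fun n => by
    rw [norm_smul, hu.norm_eq_one, mul_one, Real.norm_of_nonneg hE.le]
  have hT : Filter.Tendsto (fun n => ‖T (E • u n)‖) Filter.atTop
      (nhdsWithin 0 (Set.Ici 0)) := by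
    refine tendsto_nhdsWithin_iff.mpr ⟨?_, .of_forall fun n => norm_nonneg _⟩
    simpa [norm_smul] using hTu.const_mul |E|
  obtain ⟨n, hn⟩ := ((hω.comp hT).eventually_lt_const hE).exists
  exact ⟨E • u n, hnorm n, hn.trans_eq (hnorm n).symm⟩
end

section
/- Let a₁ < a₂ < a₃ < a₄ be real numbers, σ ∈ ℝ, and P(x) = (x−a₁)(x−a₂)(x−a₃)(x−a₄). Let λ ∈ ℝ satisfy λ > 2·(x−σ)² for all x ∈ [a₂, a₃]. Suppose f : ℝ → ℝ is twice differentiable on [a₂, a₃) and satisfies the differential equation P(x)·f''(x) + P'(x)·f'(x) = (λ − 2·(x−σ)²)·f(x) for all x ∈ [a₂, a₃), and f(a₂) > 0. Then f'(x) > 0 for all x ∈ [a₂, a₃); in particular f is strictly increasing on [a₂, a₃). -/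
open scoped RealInnerProductSpace

/-- A solution of the Sturm-Liouville equation `(p f')' = q f` with `q > 0`, started with
`f a > 0` at a boundary point `a` where `p` vanishes, has positive derivative to the right
of `a`. -/
theorem deriv_pos_of_sturmLiouville {a b : ℝ} {p q f f' : ℝ → ℝ}
    (hp : ∀ x ∈ Set.Ioo a b, 0 < p x) (hpa : p a = 0)
    (hq : ∀ x ∈ Set.Ico a b, 0 < q x)
    (hf : ∀ x ∈ Set.Ico a b, HasDerivAt f (f' x) x)
    (hode : ∀ x ∈ Set.Ico a b, HasDerivAt (fun y => p y * f' y) (q x * f x) x)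
    (hfa : 0 < f a) : ∀ x ∈ Set.Ioo a b, 0 < f' x := by
  intro x hx
  have ha : a ∈ Set.Ico a b := ⟨le_rfl, hx.1.trans hx.2⟩
  have hcont : ContinuousOn f (Set.Ico a b) :=
    fun y hy => (hf y hy).continuousAt.continuousWithinAt
  have hp_nonneg : ∀ y ∈ Set.Ico a b, 0 ≤ p y := by
    intro y hy
    rcases hy.1.eq_or_lt with rfl | h
    · exact hpa.ge
    · exact (hp y ⟨h, hy.2⟩).le
  have hmono : MonotoneOn (fun y => p y * f' y * f y) (Set.Ico a b) := by
    have hd : ∀ y ∈ Set.Ico a b, HasDerivAt (fun y => p y * f' y * f y)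
        (q y * f y * f y + p y * f' y * f' y) y := fun y hy => (hode y hy).mul (hf y hy)
    refine monotoneOn_of_hasDerivWithinAt_nonneg (convex_Ico a b)
      (fun y hy => (hd y hy).continuousAt.continuousWithinAt)
      (fun y hy => (hd y (interior_subset hy)).hasDerivWithinAt) fun y hy => ?_
    have h1 := mul_nonneg (hq y (interior_subset hy)).le (mul_self_nonneg (f y))
    have h2 := mul_nonneg (hp_nonneg y (interior_subset hy)) (mul_self_nonneg (f' y))
    linarith
  have hsq : MonotoneOn (fun y => f y * f y) (Set.Ico a b) := by
    have hd : ∀ y ∈ Set.Ico a b, HasDerivAt (fun y => f y * f y)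
        (f' y * f y + f y * f' y) y := fun y hy => (hf y hy).mul (hf y hy)
    refine monotoneOn_of_hasDerivWithinAt_nonneg (convex_Ico a b) (hcont.mul hcont)
      (fun y hy => (hd y (interior_subset hy)).hasDerivWithinAt) fun y hy => ?_
    rw [interior_Ico] at hy
    have h : 0 ≤ p y * (f' y * f y) := by
      simpa [hpa, mul_assoc] using hmono ha (Set.Ioo_subset_Ico_self hy) hy.1.le
    have := nonneg_of_mul_nonneg_right h (hp y hy)
    linarith
  have hpos : ∀ y ∈ Set.Ico a b, 0 < f y := by
    intro y hy
    by_contra! hneg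
    obtain ⟨z, hz, hz0⟩ := intermediate_value_Icc' hy.1
      (hcont.mono fun z hz => ⟨hz.1, hz.2.trans_lt hy.2⟩) ⟨hneg, hfa.le⟩
    have h : f a * f a ≤ f z * f z := hsq ha ⟨hz.1, hz.2.trans_lt hy.2⟩ hz.1
    rw [hz0] at h
    nlinarith
  have hstrict : StrictMonoOn (fun y => p y * f' y) (Set.Ico a b) :=
    strictMonoOn_of_hasDerivWithinAt_pos (convex_Ico a b)
      (fun y hy => (hode y hy).continuousAt.continuousWithinAt)
      (fun y hy => (hode y (interior_subset hy)).hasDerivWithinAt)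
      fun y hy => mul_pos (hq y (interior_subset hy)) (hpos y (interior_subset hy))
  have h : 0 < p x * f' x := by
    simpa [hpa] using hstrict ha (Set.Ioo_subset_Ico_self hx) hx.1
  exact pos_of_mul_pos_right h (hp x hx).le

/-- Lemma 2 of the paper: a bounded solution of the prolate-type ODE
`P f'' + P' f' = (λ − 2(x−σ)²) f` with `f(a₂) > 0` and `λ` large is strictly
increasing on `[a₂, a₃)`. -/
theorem ode_solution_monotone
    (a₁ a₂ a₃ a₄ σ : ℝ) (h12 : a₁ < a₂) (h23 : a₂ < a₃) (h34 : a₃ < a₄)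
    (P : ℝ → ℝ) (hP : ∀ x, P x = (x - a₁) * (x - a₂) * (x - a₃) * (x - a₄))
    (lam : ℝ) (hlam : ∀ x ∈ Set.Icc a₂ a₃, 2 * (x - σ) ^ 2 < lam)
    (f : ℝ → ℝ)
    (hf : ∀ x ∈ Set.Ico a₂ a₃, DifferentiableAt ℝ f x)
    (hf' : ∀ x ∈ Set.Ico a₂ a₃, DifferentiableAt ℝ (deriv f) x)
    (hode : ∀ x ∈ Set.Ico a₂ a₃,
      P x * deriv (deriv f) x + deriv P x * deriv f x =
        (lam - 2 * (x - σ) ^ 2) * f x)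
    (hfa₂ : 0 < f a₂) :
    (∀ x ∈ Set.Ico a₂ a₃, 0 < deriv f x) ∧ StrictMonoOn f (Set.Ico a₂ a₃) := by
  have hPd : Differentiable ℝ P := by
    rw [funext hP]
    fun_prop
  have hPa : P a₂ = 0 := by simp [hP]
  have hP_pos : ∀ x ∈ Set.Ioo a₂ a₃, 0 < P x := by
    intro x hx
    rw [hP]
    exact mul_pos_of_neg_of_neg
      (mul_neg_of_pos_of_neg
        (mul_pos (by linarith [hx.1]) (by linarith [hx.1])) (by linarith [hx.2]))
      (by linarith [hx.2])
  have hP'a : 0 < deriv P a₂ := by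
    have h : HasDerivAt P ((a₂ - a₁) * (a₂ - a₃) * (a₂ - a₄)) a₂ := by
      rw [funext hP]
      have hid (c : ℝ) : HasDerivAt (fun x : ℝ => x - c) 1 a₂ := (hasDerivAt_id a₂).sub_const c
      exact ((((hid a₁).mul (hid a₂)).mul (hid a₃)).mul (hid a₄)).congr_deriv (by simp)
    rw [h.deriv]
    exact mul_pos_of_neg_of_neg
      (mul_neg_of_pos_of_neg (by linarith) (by linarith)) (by linarith)
  have ha : a₂ ∈ Set.Ico a₂ a₃ := ⟨le_rfl, h23⟩
  have hq : ∀ x ∈ Set.Ico a₂ a₃, 0 < lam - 2 * (x - σ) ^ 2 :=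
    fun x hx => sub_pos.2 (hlam x (Set.Ico_subset_Icc_self hx))
  have hderiv : ∀ x ∈ Set.Ico a₂ a₃, 0 < deriv f x := by
    intro x hx
    rcases hx.1.eq_or_lt with rfl | hlt
    · have h := hode a₂ ha
      rw [hPa, zero_mul, zero_add] at h
      exact pos_of_mul_pos_right (h ▸ mul_pos (hq a₂ ha) hfa₂) hP'a.le
    · refine deriv_pos_of_sturmLiouville hP_pos hPa hq (fun y hy => (hf y hy).hasDerivAt)
        (fun y hy => ?_) hfa₂ x ⟨hlt, hx.2⟩
      exact ((hPd y).hasDerivAt.mul (hf' y hy).hasDerivAt).congr_deriv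
        (by rw [← hode y hy, add_comm])
  exact ⟨hderiv, strictMonoOn_of_deriv_pos (convex_Ico a₂ a₃)
    (fun x hx => (hf x hx).continuousAt.continuousWithinAt)
    fun x hx => hderiv x (interior_subset hx)⟩
end
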